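/- Let β₀ ∈ ℝ^{d₀}, σ > 0, with n₀ and d₀ fixed. Let X be n₀ × d₀ with iid N(0,1) entries, e ~ N(0, σ²I_{n₀}) independent of X, y = Xβ₀ + e. For each n > n₀ let W_n be (n - n₀) × d₀ with iid N(0,1) entries independent of (X, e), and let β̂_{(n)} = (XᵀX + W_nᵀW_n)⁻¹Xᵀy (defined a.s. for n - n₀ ≥ d₀). Then the test error R_{(n)} = σ² + E[‖((XᵀX + W_nᵀW_n)⁻¹XᵀX - I)β₀‖²] + σ²E[trace(XᵀX(XᵀX + W_nᵀW_n)⁻²)] satisfies R_{(n)} = σ² + ‖β₀‖² + O(n⁻¹) as n → ∞. -/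

import Mathlib

open MeasureTheory ProbabilityTheory Matrix

noncomputable section

/-- The Euclidean norm of a finitely indexed real vector. -/
def EN {ι : Type*} [Fintype ι] (v : ι → ℝ) : ℝ := Real.sqrt (∑ i, v i ^ 2)

lemma aux_quad {a d m : ℕ} (X : Matrix (Fin a) (Fin d) ℝ) (W : Matrix (Fin m) (Fin d) ℝ)
    (u v : Fin d → ℝ) : v ⬝ᵥ ((Xᵀ * X + Wᵀ * W) *ᵥ u) =
      (X *ᵥ v) ⬝ᵥ (X *ᵥ u) + (W *ᵥ v) ⬝ᵥ (W *ᵥ u) := by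
  rw [add_mulVec, dotProduct_add, ← mulVec_mulVec, ← mulVec_mulVec,
    dotProduct_mulVec, dotProduct_mulVec v, vecMul_transpose, vecMul_transpose]

lemma aux_dp_nonneg {ι : Type*} [Fintype ι] (v : ι → ℝ) : 0 ≤ v ⬝ᵥ v := by
  unfold dotProduct
  exact Finset.sum_nonneg fun i _ => mul_self_nonneg _

lemma aux_dp_cs {ι : Type*} [Fintype ι] (u v : ι → ℝ) : (u ⬝ᵥ v) ^ 2 ≤ (u ⬝ᵥ u) * (v ⬝ᵥ v) := by
  have := Finset.sum_mul_sq_le_sq_mul_sq Finset.univ u v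
  simpa [dotProduct, sq] using this

lemma aux_dp_young {ι : Type*} [Fintype ι] (u v : ι → ℝ) : 2 * (u ⬝ᵥ v) ≤ (u ⬝ᵥ u) + (v ⬝ᵥ v) := by
  have := aux_dp_nonneg (u - v)
  simp only [dotProduct_sub, sub_dotProduct] at this
  rw [dotProduct_comm v u] at this
  linarith

lemma aux_det {a d m : ℕ} (X : Matrix (Fin a) (Fin d) ℝ) (W : Matrix (Fin m) (Fin d) ℝ)
    {l : ℝ} (hl : 0 < l) (h : ∀ x, l * (x ⬝ᵥ x) ≤ (W *ᵥ x) ⬝ᵥ (W *ᵥ x)) :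
    IsUnit (Xᵀ * X + Wᵀ * W).det := by
  rw [isUnit_iff_ne_zero]
  intro h0
  obtain ⟨v, hv, hv0⟩ := Matrix.exists_mulVec_eq_zero_iff.mpr h0
  have := aux_quad X W v v
  rw [hv0, dotProduct_zero] at this
  have h1 := h v
  have h2 := aux_dp_nonneg (X *ᵥ v)
  have h3 := aux_dp_nonneg v
  have : v ⬝ᵥ v = 0 := by nlinarith
  exact hv (dotProduct_self_eq_zero.mp this)

lemma aux_bias {a d m : ℕ} (X : Matrix (Fin a) (Fin d) ℝ) (W : Matrix (Fin m) (Fin d) ℝ)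
    (β : Fin d → ℝ)
    {l : ℝ} (hl : 0 < l) (h : ∀ x, l * (x ⬝ᵥ x) ≤ (W *ᵥ x) ⬝ᵥ (W *ᵥ x)) :
    |EN (((Xᵀ * X + Wᵀ * W)⁻¹ * (Xᵀ * X) - 1) *ᵥ β) ^ 2 - ∑ i, β i ^ 2| ≤
      ((X *ᵥ β) ⬝ᵥ (X *ᵥ β) + (Xᵀ *ᵥ (X *ᵥ β)) ⬝ᵥ (Xᵀ *ᵥ (X *ᵥ β)) + β ⬝ᵥ β) / l := by
  have hdet := aux_det X W hl h
  set M := Xᵀ * X + Wᵀ * W with hM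
  set u := M⁻¹ *ᵥ (Xᵀ *ᵥ (X *ᵥ β)) with hu
  set b := Xᵀ *ᵥ (X *ᵥ β) with hb
  have hMu : M *ᵥ u = b := by
    rw [hu, mulVec_mulVec, mul_nonsing_inv _ hdet, one_mulVec]
  have e1 : (M⁻¹ * (Xᵀ * X) - 1) *ᵥ β = u - β := by
    rw [sub_mulVec, one_mulVec, hu, hb, mulVec_mulVec, mulVec_mulVec, Matrix.mul_assoc]
  have e2 : EN (u - β) ^ 2 - ∑ i, β i ^ 2 = u ⬝ᵥ u - 2 * (u ⬝ᵥ β) := by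
    unfold EN
    rw [Real.sq_sqrt (Finset.sum_nonneg fun i _ => sq_nonneg _)]
    simp only [dotProduct, Finset.mul_sum, ← Finset.sum_sub_distrib, Pi.sub_apply]
    exact Finset.sum_congr rfl fun i _ => by ring
  rw [e1, e2]
  have q := aux_quad X W u u
  rw [← hM, hMu] at q
  have hub : u ⬝ᵥ b = (X *ᵥ u) ⬝ᵥ (X *ᵥ β) := by
    rw [hb, dotProduct_mulVec, vecMul_transpose]
  have hw := h u
  have y := aux_dp_young (X *ᵥ u) (X *ᵥ β)
  have nX := aux_dp_nonneg (X *ᵥ u)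
  have nXb := aux_dp_nonneg (X *ᵥ β)
  have nu := aux_dp_nonneg u
  have nb := aux_dp_nonneg b
  have nβ := aux_dp_nonneg β
  have nW := aux_dp_nonneg (W *ᵥ u)
  have k1 : l * (u ⬝ᵥ u) ≤ (X *ᵥ β) ⬝ᵥ (X *ᵥ β) := by nlinarith
  have k2 : l * (u ⬝ᵥ u) ≤ u ⬝ᵥ b := by nlinarith
  have c1 := aux_dp_cs u b
  -- l^2 |u|^2 ≤ |b|^2
  have k3 : l ^ 2 * (u ⬝ᵥ u) ≤ b ⬝ᵥ b := by
    rcases nu.eq_or_lt with h0 | h0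
    · rw [← h0]; simpa using nb
    · have : (l * (u ⬝ᵥ u)) ^ 2 ≤ (u ⬝ᵥ u) * (b ⬝ᵥ b) :=
        (pow_le_pow_left₀ (by positivity) k2 2).trans c1
      have : (u ⬝ᵥ u) * (l ^ 2 * (u ⬝ᵥ u)) ≤ (u ⬝ᵥ u) * (b ⬝ᵥ b) := by nlinarith
      exact le_of_mul_le_mul_left this h0
  have k4 : l * |2 * (u ⬝ᵥ β)| ≤ b ⬝ᵥ b + β ⬝ᵥ β := by
    have p1 := aux_dp_young (l • u) β
    have p2 := aux_dp_young (-(l • u)) β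
    simp only [smul_dotProduct, dotProduct_smul, neg_dotProduct, dotProduct_neg, smul_eq_mul] at p1 p2
    rw [← abs_of_pos hl, ← abs_mul, abs_le]
    constructor <;> nlinarith
  rw [le_div_iff₀ hl]
  have k5 : |u ⬝ᵥ u - 2 * (u ⬝ᵥ β)| ≤ u ⬝ᵥ u + |2 * (u ⬝ᵥ β)| := by
    refine (abs_sub _ _).trans ?_
    rw [abs_of_nonneg nu]
  nlinarith

lemma aux_var {a d m : ℕ} (X : Matrix (Fin a) (Fin d) ℝ) (W : Matrix (Fin m) (Fin d) ℝ)
    {l : ℝ} (hl : 0 < l) (h : ∀ x, l * (x ⬝ᵥ x) ≤ (W *ᵥ x) ⬝ᵥ (W *ᵥ x)) :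
    |((Xᵀ * X) * ((Xᵀ * X + Wᵀ * W)⁻¹ * (Xᵀ * X + Wᵀ * W)⁻¹)).trace| ≤ a / l := by
  have hdet := aux_det X W hl h
  set M := Xᵀ * X + Wᵀ * W with hM
  have hMs : M⁻¹ᵀ = M⁻¹ := by
    rw [transpose_nonsing_inv, hM]; simp
  have e : ((Xᵀ * X) * (M⁻¹ * M⁻¹)).trace = ∑ i, (M⁻¹ *ᵥ (X i)) ⬝ᵥ (M⁻¹ *ᵥ (X i)) := by
    rw [Matrix.mul_assoc, trace_mul_comm]
    unfold trace
    refine Finset.sum_congr rfl fun i _ => ?_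
    have : X * (M⁻¹ * M⁻¹) * Xᵀ = (M⁻¹ * Xᵀ)ᵀ * (M⁻¹ * Xᵀ) := by
      rw [transpose_mul, hMs, transpose_transpose]; simp only [Matrix.mul_assoc]
    rw [this]
    rfl
  have key : ∀ i, (M⁻¹ *ᵥ (X i)) ⬝ᵥ (M⁻¹ *ᵥ (X i)) ≤ 1 / l := by
    intro i
    set u := M⁻¹ *ᵥ (X i) with hu
    have hMu : M *ᵥ u = X i := by
      rw [hu, mulVec_mulVec, mul_nonsing_inv _ hdet, one_mulVec]
    have q := aux_quad X W u u
    rw [← hM, hMu] at q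
    have hw := h u
    have nu := aux_dp_nonneg u
    have hx : (u ⬝ᵥ X i) ^ 2 ≤ (X *ᵥ u) ⬝ᵥ (X *ᵥ u) := by
      have := Finset.single_le_sum (f := fun j => (X *ᵥ u) j * (X *ᵥ u) j)
        (fun j _ => mul_self_nonneg _) (Finset.mem_univ i)
      refine le_trans (le_of_eq ?_) this
      rw [dotProduct_comm, sq]; rfl
    rw [le_div_iff₀ hl]
    have := mul_nonneg hl.le nu
    nlinarith [sq_nonneg (u ⬝ᵥ X i - 1)]
  rw [e, abs_of_nonneg (Finset.sum_nonneg fun i _ => aux_dp_nonneg _)]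
  refine (Finset.sum_le_sum fun i _ => key i).trans ?_
  simp [div_eq_mul_inv]

/-- lower bound for the square of the smallest singular value -/
def lam {d : ℕ} (G : Fin d → Fin d → ℝ) : ℝ :=
  (Matrix.of G).det ^ 2 / (1 + ∑ i, ∑ j, (Matrix.of G).adjugate i j ^ 2)

lemma lam_nonneg {d : ℕ} (G : Fin d → Fin d → ℝ) : 0 ≤ lam G := by
  unfold lam; positivity

lemma lam_spec {d : ℕ} (G : Fin d → Fin d → ℝ) (x : Fin d → ℝ) :
    lam G * (x ⬝ᵥ x) ≤ (Matrix.of G *ᵥ x) ⬝ᵥ (Matrix.of G *ᵥ x) := by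
  unfold lam
  set A := Matrix.of G
  have h1 : A.adjugate *ᵥ (A *ᵥ x) = A.det • x := by
    rw [mulVec_mulVec, adjugate_mul, smul_mulVec, one_mulVec]
  have ny := aux_dp_nonneg (A *ᵥ x)
  have h2 : A.det ^ 2 * (x ⬝ᵥ x) ≤
      (∑ i, ∑ j, A.adjugate i j ^ 2) * ((A *ᵥ x) ⬝ᵥ (A *ᵥ x)) := by
    have : A.det ^ 2 * (x ⬝ᵥ x) = (A.adjugate *ᵥ (A *ᵥ x)) ⬝ᵥ (A.adjugate *ᵥ (A *ᵥ x)) := by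
      rw [h1]; simp; ring
    rw [this, Finset.sum_mul]
    refine Finset.sum_le_sum fun i _ => ?_
    have := aux_dp_cs (A.adjugate i) (A *ᵥ x)
    rw [← sq]
    refine this.trans (le_of_eq ?_)
    congr 1
    simp [dotProduct, sq]
  rw [div_mul_eq_mul_div, div_le_iff₀ (by positivity)]
  nlinarith

open scoped ENNReal

lemma aux_comp_inj {ι κ α : Type*} [Fintype ι] [Fintype κ] [MeasurableSpace α]
    (μ : Measure α) [IsProbabilityMeasure μ] (f : ι → κ) (hf : Function.Injective f) :
    MeasurePreserving (fun (w : κ → α) (i : ι) => w (f i))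
      (Measure.pi fun _ => μ) (Measure.pi fun _ => μ) := by
  classical
  refine ⟨by fun_prop, ?_⟩
  symm
  refine Measure.pi_eq fun s hs => ?_
  rw [Measure.map_apply (by fun_prop) (MeasurableSet.univ_pi hs)]
  have : (fun (w : κ → α) (i : ι) => w (f i)) ⁻¹' (Set.univ.pi s) =
      Set.univ.pi (fun k => ⋂ (i : ι) (_ : f i = k), s i) := by
    ext w
    simp only [Set.mem_preimage, Set.mem_pi, Set.mem_univ, true_imp_iff, Set.mem_iInter]
    exact ⟨fun h k i hi => hi ▸ h i, fun h i => h _ i rfl⟩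
  rw [this, Measure.pi_pi]
  have h1 : ∀ k ∉ Finset.univ.image f, μ (⋂ (i : ι) (_ : f i = k), s i) = 1 := by
    intro k hk
    have : (⋂ (i : ι) (_ : f i = k), s i) = Set.univ := by
      refine Set.iInter_eq_univ.mpr fun i => Set.iInter_eq_univ.mpr fun hi => ?_
      exact absurd (Finset.mem_image.mpr ⟨i, Finset.mem_univ _, hi⟩) hk
    rw [this, measure_univ]
  rw [← Finset.prod_subset (Finset.subset_univ (Finset.univ.image f)) (fun k _ hk => h1 k hk),
    Finset.prod_image (fun a _ b _ h => hf h)]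
  refine Finset.prod_congr rfl fun i _ => ?_
  congr 1
  ext x
  simp only [Set.mem_iInter]
  exact ⟨fun h => h i rfl, fun h j hj => hf hj ▸ h⟩

lemma aux_uncurry {ι κ α : Type*} [Fintype ι] [Fintype κ] [MeasurableSpace α]
    (μ : Measure α) [IsProbabilityMeasure μ] :
    MeasurePreserving (fun (w : ι → κ → α) (p : ι × κ) => w p.1 p.2)
      (Measure.pi fun _ => Measure.pi fun _ => μ) (Measure.pi fun _ => μ) := by
  refine ⟨by fun_prop, ?_⟩
  symm
  refine Measure.pi_eq fun s hs => ?_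
  rw [Measure.map_apply (by fun_prop) (MeasurableSet.univ_pi hs)]
  have : (fun (w : ι → κ → α) (p : ι × κ) => w p.1 p.2) ⁻¹' (Set.univ.pi s) =
      Set.univ.pi (fun i => Set.univ.pi fun j => s (i, j)) := by
    ext w
    simp [Set.mem_pi]
  rw [this, Measure.pi_pi, Fintype.prod_prod_type]
  simp_rw [Measure.pi_pi]

lemma aux_lintegral_prod {α : Type*} [MeasurableSpace α]
    (μ : Measure α) [IsProbabilityMeasure μ] (h : α → ℝ≥0∞) (hh : Measurable h) (k : ℕ) :
    ∫⁻ w : Fin k → α, ∏ i, h (w i) ∂(Measure.pi fun _ => μ) = (∫⁻ x, h x ∂μ) ^ k := by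
  induction k with
  | zero => simp
  | succ k ih =>
    have mp := measurePreserving_piFinSuccAbove (fun _ : Fin (k+1) => μ) 0
    rw [← mp.symm.lintegral_comp (by fun_prop)]
    have : ∀ p : α × (Fin k → α), ∏ i, h (((MeasurableEquiv.piFinSuccAbove (fun _ => α) 0).symm p) i)
       = h p.1 * ∏ i, h (p.2 i) := by
      intro p
      rw [Fin.prod_univ_succ]
      simp [MeasurableEquiv.piFinSuccAbove]
    simp_rw [this]
    rw [lintegral_prod_mul (f := h) (g := fun w : Fin k → α => ∏ i, h (w i)) hh.aemeasurable
      (Finset.measurable_prod _ fun i _ => hh.comp (measurable_pi_apply i)).aemeasurable, ih, pow_succ']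

lemma aux_pow_int : ∫⁻ y in Set.Ioo (-1:ℝ) 1, ENNReal.ofReal |y| ^ (-1/2:ℝ) < ∞ := by
  have hI : IntegrableOn (fun y : ℝ => y ^ (-1/2:ℝ)) (Set.Ioc 0 1) := by
    have := intervalIntegral.intervalIntegrable_rpow' (a := 0) (b := 1) (r := -1/2) (by norm_num)
    exact (intervalIntegrable_iff_integrableOn_Ioc_of_le zero_le_one).mp this
  have h1 : ∫⁻ y in Set.Ioc (0:ℝ) 1, ENNReal.ofReal |y| ^ (-1/2:ℝ) < ∞ := by
    have := hI.lintegral_lt_top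
    refine lt_of_le_of_lt (le_of_eq ?_) this
    refine setLIntegral_congr_fun measurableSet_Ioc fun y hy => ?_
    rw [abs_of_pos hy.1, ENNReal.ofReal_rpow_of_pos hy.1]
  have h2 : ∫⁻ y in Set.Ico (-1:ℝ) 0, ENNReal.ofReal |y| ^ (-1/2:ℝ) < ∞ := by
    have mp := (Measure.measurePreserving_neg (volume : Measure ℝ))
    have := mp.setLIntegral_comp_preimage (s := Set.Ioc (0:ℝ) 1) measurableSet_Ioc
      (f := fun y => ENNReal.ofReal |y| ^ (-1/2:ℝ)) (by fun_prop)
    rw [← this] at h1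
    simpa using h1
  have hs : Set.Ioo (-1:ℝ) 1 ⊆ (Set.Ico (-1:ℝ) 0 ∪ Set.Ioc 0 1) ∪ {0} := by
    intro y hy
    rcases lt_trichotomy y 0 with h | h | h
    · exact Or.inl (Or.inl ⟨hy.1.le, h⟩)
    · exact Or.inr h
    · exact Or.inl (Or.inr ⟨h, hy.2.le⟩)
  refine lt_of_le_of_lt (lintegral_mono_set hs) ?_
  refine lt_of_le_of_lt (lintegral_union_le _ _ _) ?_
  refine ENNReal.add_lt_top.mpr ⟨?_, by simp⟩
  refine lt_of_le_of_lt (lintegral_union_le _ _ _) ?_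
  exact ENNReal.add_lt_top.mpr ⟨h2, h1⟩

lemma aux_gauss_le (f : ℝ → ℝ≥0∞) (hf : Measurable f) :
    ∫⁻ x, f x ∂(gaussianReal 0 1) ≤ ∫⁻ x, f x := by
  rw [gaussianReal_of_var_ne_zero _ one_ne_zero, lintegral_withDensity_eq_lintegral_mul _
    (measurable_gaussianPDF _ _) hf]
  refine lintegral_mono fun x => ?_
  simp only [Pi.mul_apply]
  refine mul_le_of_le_one_left zero_le ?_
  unfold gaussianPDF gaussianPDFReal
  rw [ENNReal.ofReal_le_one]
  refine mul_le_one₀ ?_ (Real.exp_pos _).le (Real.exp_le_one_iff.mpr ?_)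
  · refine inv_le_one_of_one_le₀ (Real.one_le_sqrt.mpr ?_)
    have := Real.pi_gt_three
    simp; linarith
  · have := sq_nonneg (x - 0)
    simp only [NNReal.coe_one, mul_one]
    linarith

lemma aux_one_dim : ∃ C : ℝ≥0∞, C ≠ ∞ ∧ ∀ a b : ℝ,
    ∫⁻ x, ENNReal.ofReal |a * x + b| ^ (-1/2:ℝ) ∂(gaussianReal 0 1) ≤
      C * ENNReal.ofReal |a| ^ (-1/2:ℝ) := by
  refine ⟨1 + ∫⁻ y in Set.Ioo (-1:ℝ) 1, ENNReal.ofReal |y| ^ (-1/2:ℝ),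
    ENNReal.add_ne_top.mpr ⟨by simp, aux_pow_int.ne⟩, fun a b => ?_⟩
  set g : ℝ → ℝ≥0∞ := (Set.Ioo (-1:ℝ) 1).indicator (fun y => ENNReal.ofReal |y| ^ (-1/2:ℝ)) with hg
  have gm : Measurable g := Measurable.indicator (by fun_prop) measurableSet_Ioo
  rcases eq_or_ne a 0 with rfl | ha
  · have : ENNReal.ofReal |(0:ℝ)| ^ (-1/2:ℝ) = ∞ := by
      simp only [abs_zero, ENNReal.ofReal_zero]
      exact ENNReal.zero_rpow_of_neg (by norm_num)
    rw [this, ENNReal.mul_top (by simp)]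
    exact le_top
  · have e : ∀ x, ENNReal.ofReal |a * x + b| ^ (-1/2:ℝ) =
        ENNReal.ofReal |x + b / a| ^ (-1/2:ℝ) * ENNReal.ofReal |a| ^ (-1/2:ℝ) := by
      intro x
      have : a * x + b = (x + b / a) * a := by field_simp
      rw [this, abs_mul, ENNReal.ofReal_mul (abs_nonneg _), ENNReal.mul_rpow_of_ne_top (by simp) (by simp)]
    simp_rw [e]
    rw [lintegral_mul_const _ (by fun_prop)]
    gcongr
    have p : ∀ x, ENNReal.ofReal |x + b / a| ^ (-1/2:ℝ) ≤ 1 + g (x + b / a) := by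
      intro x
      by_cases hx : x + b / a ∈ Set.Ioo (-1:ℝ) 1
      · rw [hg, Set.indicator_of_mem hx]; exact le_add_self
      · refine le_trans ?_ le_self_add
        have : 1 ≤ |x + b / a| := by
          by_contra h
          exact hx (abs_lt.mp (not_le.mp h))
        exact ENNReal.rpow_le_one_of_one_le_of_neg (by simpa using this) (by norm_num)
    refine (lintegral_mono p).trans ?_
    rw [lintegral_add_left (by fun_prop)]
    simp only [lintegral_const, measure_univ, mul_one]
    refine add_le_add le_rfl ?_
    refine (aux_gauss_le (fun x => g (x + b / a)) (by fun_prop)).trans ?_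
    rw [lintegral_add_right_eq_self g, hg, lintegral_indicator measurableSet_Ioo]

/-- standard Gaussian measure on matrices -/
abbrev gm (a d : ℕ) : Measure (Fin a → Fin d → ℝ) :=
  Measure.pi fun _ : Fin a => Measure.pi fun _ : Fin d => gaussianReal 0 1

lemma meas_det {d : ℕ} : Measurable (fun G : Fin d → Fin d → ℝ => (Matrix.of G).det) :=
  (Continuous.matrix_det (A := fun G : Fin d → Fin d → ℝ => Matrix.of G) (by exact continuous_id)).measurable

lemma aux_detmom (d : ℕ) :
    ∫⁻ G, ENNReal.ofReal |(Matrix.of G).det| ^ (-1/2:ℝ) ∂(gm d d) < ∞ := by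
  induction d with
  | zero => simp
  | succ d ih =>
    obtain ⟨C, hC, h1⟩ := aux_one_dim
    -- split off row zero
    have mp := measurePreserving_piFinSuccAbove
      (fun _ : Fin (d+1) => Measure.pi fun _ : Fin (d+1) => gaussianReal 0 1) 0
    have mp2 := measurePreserving_piFinSuccAbove (fun _ : Fin (d+1) => gaussianReal 0 1) 0
    have md : Measurable (fun G : Fin (d+1) → Fin (d+1) → ℝ =>
      ENNReal.ofReal |(Matrix.of G).det| ^ (-1/2:ℝ)) := by
      have := meas_det (d := d+1)
      fun_prop
    have tail : MeasurePreserving (fun (w : Fin d → Fin (d+1) → ℝ) (i : Fin d) (j : Fin d) => w i j.succ)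
        (gm d (d+1)) (gm d d) :=
      measurePreserving_pi (fun _ : Fin d => Measure.pi fun _ : Fin (d+1) => gaussianReal 0 1)
        (fun _ : Fin d => Measure.pi fun _ : Fin d => gaussianReal 0 1)
        (fun _ => aux_comp_inj (gaussianReal 0 1) Fin.succ (Fin.succ_injective d))
    have mdd : Measurable (fun G : Fin d → Fin d → ℝ =>
      ENNReal.ofReal |(Matrix.of G).det| ^ (-1/2:ℝ)) := by
      have := meas_det (d := d)
      fun_prop
    unfold gm
    rw [← mp.symm.lintegral_comp md]
    refine lt_of_le_of_lt (lintegral_prod_symm _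
      (md.comp (MeasurableEquiv.measurable _)).aemeasurable).le ?_
    have key : ∀ w : Fin d → Fin (d+1) → ℝ,
        ∫⁻ r, ENNReal.ofReal |(Matrix.of ((MeasurableEquiv.piFinSuccAbove
          (fun _ => Fin (d+1) → ℝ) 0).symm (r, w))).det| ^ (-1/2:ℝ)
          ∂(Measure.pi fun _ : Fin (d+1) => gaussianReal 0 1) ≤
        C * ENNReal.ofReal |(Matrix.of (fun i j : Fin d => w i j.succ)).det| ^ (-1/2:ℝ) := by
      intro w
      have md' : Measurable (fun r : Fin (d+1) → ℝ => ENNReal.ofReal |(Matrix.of ((MeasurableEquiv.piFinSuccAbove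
          (fun _ => Fin (d+1) → ℝ) 0).symm (r, w))).det| ^ (-1/2:ℝ)) :=
        md.comp ((MeasurableEquiv.measurable _).comp (by fun_prop))
      rw [← mp2.symm.lintegral_comp md']
      refine (lintegral_prod_symm _
        (md'.comp (MeasurableEquiv.measurable _)).aemeasurable).le.trans ?_
      have key2 : ∀ t : Fin d → ℝ, ∃ b : ℝ, ∀ x : ℝ,
          (Matrix.of ((MeasurableEquiv.piFinSuccAbove (fun _ => Fin (d+1) → ℝ) 0).symm
            (((MeasurableEquiv.piFinSuccAbove (fun _ => ℝ) 0).symm (x, t)), w))).det =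
          (Matrix.of (fun i j : Fin d => w i j.succ)).det * x + b := by
        intro t
        refine ⟨∑ j : Fin d, (-1) ^ (j.succ : ℕ) * t j *
          (Matrix.of fun i k : Fin d => w i (j.succ.succAbove k)).det, fun x => ?_⟩
        rw [det_succ_row_zero, Fin.sum_univ_succ, mul_comm (Matrix.det _) x]
        congr 1
        · simp [MeasurableEquiv.piFinSuccAbove]
          left
          congr 1
      calc _ ≤ ∫⁻ t : Fin d → ℝ, C * ENNReal.ofReal |(Matrix.of (fun i j : Fin d => w i j.succ)).det| ^ (-1/2:ℝ)
              ∂(Measure.pi fun _ : Fin d => gaussianReal 0 1) := by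
            refine lintegral_mono fun t => ?_
            obtain ⟨b, hb⟩ := key2 t
            refine le_trans (le_of_eq ?_) (h1 _ b)
            refine lintegral_congr fun x => ?_
            exact congrArg (fun z : ℝ => ENNReal.ofReal |z| ^ (-1/2:ℝ)) (hb x)
        _ = _ := by simp
    refine lt_of_le_of_lt (lintegral_mono key) ?_
    refine lt_of_le_of_lt (lintegral_const_mul _ (mdd.comp tail.measurable)).le ?_
    refine ENNReal.mul_lt_top hC.lt_top ?_
    have := tail.lintegral_comp mdd
    unfold gm at this
    exact lt_of_eq_of_lt this ih

/-- all moments are finite -/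
def AllLp {α : Type*} [MeasurableSpace α] (μ : Measure α) (f : α → ℝ) : Prop :=
  ∀ k : ℕ, MemLp f k μ

lemma AllLp.const {α : Type*} [MeasurableSpace α] (μ : Measure α) [IsProbabilityMeasure μ] (c : ℝ) :
    AllLp μ (fun _ => c) := fun _ => memLp_const c

lemma AllLp.mul {α : Type*} [MeasurableSpace α] {μ : Measure α} {f g : α → ℝ}
    (hf : AllLp μ f) (hg : AllLp μ g) : AllLp μ (fun x => f x * g x) := by
  intro k
  have : ENNReal.HolderTriple ((2 * k : ℕ) : ℝ≥0∞) ((2 * k : ℕ) : ℝ≥0∞) (k : ℝ≥0∞) := by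
    constructor
    push_cast
    rw [ENNReal.mul_inv (by simp) (by simp), ← add_mul, ENNReal.inv_two_add_inv_two, one_mul]
  exact MemLp.mul (hg (2 * k)) (hf (2 * k))

lemma AllLp.sum {α ι : Type*} [MeasurableSpace α] {μ : Measure α} (s : Finset ι) {f : ι → α → ℝ}
    (hf : ∀ i ∈ s, AllLp μ (f i)) : AllLp μ (fun x => ∑ i ∈ s, f i x) :=
  fun k => memLp_finsetSum s fun i hi => hf i hi k

lemma AllLp.add {α : Type*} [MeasurableSpace α] {μ : Measure α} {f g : α → ℝ}
    (hf : AllLp μ f) (hg : AllLp μ g) : AllLp μ (fun x => f x + g x) :=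
  fun k => (hf k).add (hg k)

lemma AllLp.prod {α ι : Type*} [MeasurableSpace α] {μ : Measure α} [IsProbabilityMeasure μ]
    (s : Finset ι) {f : ι → α → ℝ}
    (hf : ∀ i ∈ s, AllLp μ (f i)) : AllLp μ (fun x => ∏ i ∈ s, f i x) := by
  classical
  induction s using Finset.induction_on with
  | empty => simpa using AllLp.const μ 1
  | insert a s ha ih =>
    simp_rw [Finset.prod_insert ha]
    exact (hf a (by simp)).mul (ih fun i hi => hf i (by simp [hi]))

lemma AllLp.coord {a d : ℕ} (i : Fin a) (j : Fin d) : AllLp (gm a d) (fun G => G i j) := by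
  intro k
  have h1 : MeasurePreserving (fun G : Fin a → Fin d → ℝ => G i j) (gm a d) (gaussianReal 0 1) :=
    (measurePreserving_eval (fun _ : Fin d => gaussianReal 0 1) j).comp
      (measurePreserving_eval (fun _ : Fin a => Measure.pi fun _ : Fin d => gaussianReal 0 1) i)
  exact (memLp_id_gaussianReal' (μ := 0) (v := 1) (k : ℝ≥0∞) (by simp)).comp_measurePreserving h1

lemma AllLp.adj {d : ℕ} (i j : Fin d) :
    AllLp (gm d d) (fun G => (Matrix.of G).adjugate i j) := by
  simp_rw [adjugate_apply, det_apply]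
  refine AllLp.sum _ fun s _ => ?_
  have : ∀ G : Fin d → Fin d → ℝ, Equiv.Perm.sign s • ∏ k, (Matrix.of G).updateRow j (Pi.single i 1) (s k) k
      = ((Equiv.Perm.sign s : ℤ) : ℝ) * ∏ k, (Matrix.of G).updateRow j (Pi.single i 1) (s k) k := by
    intro G
    rw [Units.smul_def, zsmul_eq_mul]
  simp_rw [this]
  refine (AllLp.const _ _).mul (AllLp.prod _ fun k _ => ?_)
  by_cases h : s k = j
  · simp only [h, updateRow_self]
    exact AllLp.const _ _
  · simp only [updateRow_ne h]
    exact AllLp.coord _ _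

lemma AllLp.lint {α : Type*} [MeasurableSpace α] {μ : Measure α} {f : α → ℝ} (hf : AllLp μ f) :
    ∫⁻ x, ENNReal.ofReal (f x) ∂μ < ∞ := by
  have := hf 1
  rw [Nat.cast_one, memLp_one_iff_integrable] at this
  exact this.lintegral_lt_top

lemma meas_lam {d : ℕ} : Measurable (fun G : Fin d → Fin d → ℝ => lam G) := by
  have h1 := meas_det (d := d)
  have h2 : ∀ i j, Measurable (fun G : Fin d → Fin d → ℝ => (Matrix.of G).adjugate i j) := by
    intro i j
    have := Continuous.matrix_adjugate (A := fun G : Fin d → Fin d → ℝ => Matrix.of G)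
      (by exact continuous_id)
    exact (this.matrix_elem i j).measurable
  unfold lam
  fun_prop

lemma aux_lam_pt {d : ℕ} (G : Fin d → Fin d → ℝ) :
    ENNReal.ofReal (lam G) ^ (-1/8:ℝ) ≤ ENNReal.ofReal |(Matrix.of G).det| ^ (-1/2:ℝ) +
      ENNReal.ofReal (1 + ∑ i, ∑ j, (Matrix.of G).adjugate i j * (Matrix.of G).adjugate i j) := by
  simp_rw [← sq]
  unfold lam
  set D := (Matrix.of G).det
  set a := 1 + ∑ i, ∑ j, (Matrix.of G).adjugate i j ^ 2 with ha
  have ha1 : 1 ≤ a := by rw [ha]; simp; positivity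
  set s := ENNReal.ofReal a
  have hs : 1 ≤ s := by simpa [s] using ha1
  set v := ENNReal.ofReal |D| ^ (-1/2:ℝ) with hv
  have e : (ENNReal.ofReal (D ^ 2 / a))⁻¹ = s * v ^ 4 := by
    rw [ENNReal.ofReal_div_of_pos (by linarith), ENNReal.inv_div (by simp) (by left; simp; linarith),
      div_eq_mul_inv, ← sq_abs, ENNReal.ofReal_pow (abs_nonneg _)]
    congr 1
    rw [hv, ← ENNReal.rpow_natCast, ← ENNReal.rpow_natCast, ← ENNReal.rpow_mul, ← ENNReal.rpow_neg]
    norm_num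
  have e2 : s * v ^ 4 ≤ (v + s) ^ 8 := by
    calc s * v ^ 4 ≤ (v + s) * (v + s) ^ 4 := by gcongr <;> simp
      _ = (v + s) ^ 5 := by ring
      _ ≤ (v + s) ^ 8 := pow_le_pow_right₀ (hs.trans le_add_self) (by norm_num)
  have : (-1/8:ℝ) = -(1/8) := by norm_num
  rw [this, ENNReal.rpow_neg, ← ENNReal.inv_rpow, e]
  calc (s * v ^ 4) ^ (1/8:ℝ) ≤ ((v + s) ^ 8) ^ (1/8:ℝ) := by gcongr
    _ = v + s := by
      rw [← ENNReal.rpow_natCast, ← ENNReal.rpow_mul]; norm_num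

lemma aux_lam_mom (d : ℕ) : ∫⁻ G, ENNReal.ofReal (lam G) ^ (-1/8:ℝ) ∂(gm d d) < ∞ := by
  refine lt_of_le_of_lt (lintegral_mono aux_lam_pt) ?_
  have := meas_det (d := d)
  rw [lintegral_add_left (by fun_prop)]
  refine ENNReal.add_lt_top.mpr ⟨aux_detmom d, AllLp.lint ?_⟩
  exact (AllLp.const _ _).add (AllLp.sum _ fun i _ => AllLp.sum _ fun j _ => (AllLp.adj i j).mul (AllLp.adj i j))

lemma aux_inv_sum8 (x : Fin 8 → ℝ≥0∞) : (∑ k, x k)⁻¹ ≤ ∏ k, x k ^ (-1/8:ℝ) := by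
  have : (∑ k, x k)⁻¹ = ∏ _k : Fin 8, (∑ k, x k) ^ (-1/8:ℝ) := by
    rw [Finset.prod_const, ← ENNReal.rpow_natCast, ← ENNReal.rpow_mul]
    simp [ENNReal.rpow_neg_one]
  rw [this]
  refine Finset.prod_le_prod' fun k _ => ?_
  have h8 : (-1/8:ℝ) = -(1/8) := by norm_num
  rw [h8, ENNReal.rpow_neg, ENNReal.rpow_neg]
  refine ENNReal.inv_le_inv.mpr (ENNReal.rpow_le_rpow ?_ (by norm_num))
  exact Finset.single_le_sum (fun _ _ => zero_le) (Finset.mem_univ k)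

lemma aux_harm {J : ℕ} (hJ : 0 < J) (S : Fin J → ℝ) (hS : ∀ j, 0 ≤ S j) :
    (ENNReal.ofReal (∑ j, S j))⁻¹ ≤ ((J : ℝ≥0∞)⁻¹) ^ 2 * ∑ j, (ENNReal.ofReal (S j))⁻¹ := by
  have hJ' : (0:ℝ) < J := by exact_mod_cast hJ
  by_cases h : ∃ j, S j = 0
  · obtain ⟨j, hj⟩ := h
    have : ∑ j, (ENNReal.ofReal (S j))⁻¹ = ∞ :=
      ENNReal.sum_eq_top.mpr ⟨j, Finset.mem_univ _, by simp [hj]⟩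
    rw [this, ENNReal.mul_top (by simp)]
    exact le_top
  · push Not at h
    have hp : ∀ j, 0 < S j := fun j => lt_of_le_of_ne (hS j) (h j).symm
    have hne : (Finset.univ : Finset (Fin J)).Nonempty := ⟨⟨0, hJ⟩, Finset.mem_univ _⟩
    have hsum : 0 < ∑ j, S j := Finset.sum_pos (fun j _ => hp j) hne
    have cs := Finset.sq_sum_div_le_sum_sq_div (Finset.univ : Finset (Fin J)) (fun _ => (1:ℝ)) (g := S) (fun j _ => hp j)
    simp only [Finset.sum_const, Finset.card_univ, Fintype.card_fin, nsmul_eq_mul, mul_one, one_pow] at cs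
    have r : (∑ j, S j)⁻¹ ≤ ((J:ℝ)⁻¹) ^ 2 * ∑ j, (S j)⁻¹ := by
      simp only [one_div] at cs
      calc (∑ j, S j)⁻¹ = ((J:ℝ)⁻¹) ^ 2 * ((J:ℝ) ^ 2 / ∑ j, S j) := by field_simp
        _ ≤ _ := by gcongr
    have : ((J : ℝ≥0∞)⁻¹) ^ 2 * ∑ j, (ENNReal.ofReal (S j))⁻¹ =
        ENNReal.ofReal (((J:ℝ)⁻¹) ^ 2 * ∑ j, (S j)⁻¹) := by
      rw [ENNReal.ofReal_mul (by positivity), ENNReal.ofReal_pow (by positivity),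
        ENNReal.ofReal_inv_of_pos hJ', ENNReal.ofReal_natCast, ENNReal.ofReal_sum_of_nonneg
        (fun j _ => by have := hp j; positivity)]
      simp_rw [fun j => ENNReal.ofReal_inv_of_pos (hp j)]
    rw [this, ← ENNReal.ofReal_inv_of_pos hsum]
    exact ENNReal.ofReal_le_ofReal r

/-- lower bound for the smallest eigenvalue of `WᵀW` built from blocks -/
def Lam {J d m : ℕ} (f : Fin J × (Fin 8 × Fin d) → Fin m) (W : Fin m → Fin d → ℝ) : ℝ :=
  ∑ j, ∑ k, lam (fun i => W (f (j, (k, i))))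

lemma meas_Lam {J d m : ℕ} (f : Fin J × (Fin 8 × Fin d) → Fin m) : Measurable (Lam f) := by
  have := meas_lam (d := d)
  unfold Lam
  refine Finset.measurable_sum _ fun j _ => Finset.measurable_sum _ fun k _ => ?_
  exact this.comp (by fun_prop)

lemma Lam_nonneg {J d m : ℕ} (f : Fin J × (Fin 8 × Fin d) → Fin m) (W : Fin m → Fin d → ℝ) :
    0 ≤ Lam f W := Finset.sum_nonneg fun _ _ => Finset.sum_nonneg fun _ _ => lam_nonneg _

lemma Lam_spec {J d m : ℕ} (f : Fin J × (Fin 8 × Fin d) → Fin m) (hf : Function.Injective f)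
    (W : Fin m → Fin d → ℝ) (x : Fin d → ℝ) :
    Lam f W * (x ⬝ᵥ x) ≤ (Matrix.of W *ᵥ x) ⬝ᵥ (Matrix.of W *ᵥ x) := by
  classical
  unfold Lam
  have h1 : ∑ p, (W (f p) ⬝ᵥ x) * (W (f p) ⬝ᵥ x) ≤ (Matrix.of W *ᵥ x) ⬝ᵥ (Matrix.of W *ᵥ x) := by
    have : ∑ p, (W (f p) ⬝ᵥ x) * (W (f p) ⬝ᵥ x) =
        ∑ i ∈ Finset.univ.image f, (W i ⬝ᵥ x) * (W i ⬝ᵥ x) := by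
      rw [Finset.sum_image (fun a _ b _ h => hf h)]
    rw [this]
    exact Finset.sum_le_sum_of_subset_of_nonneg (Finset.subset_univ _) fun i _ _ => mul_self_nonneg _
  refine le_trans ?_ h1
  rw [Fintype.sum_prod_type, Finset.sum_mul]
  refine Finset.sum_le_sum fun j _ => ?_
  rw [Fintype.sum_prod_type, Finset.sum_mul]
  refine Finset.sum_le_sum fun k _ => ?_
  exact lam_spec _ x

lemma aux_block {J d m : ℕ} (f : Fin J × (Fin 8 × Fin d) → Fin m) (hf : Function.Injective f)
    (j : Fin J) :
    ∫⁻ W, (ENNReal.ofReal (∑ k, lam (fun i => W (f (j, (k, i))))))⁻¹ ∂(gm m d) ≤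
      (∫⁻ G, ENNReal.ofReal (lam G) ^ (-1/8:ℝ) ∂(gm d d)) ^ 8 := by
  have ml := meas_lam (d := d)
  set h : (Fin d → Fin d → ℝ) → ℝ≥0∞ := fun G => ENNReal.ofReal (lam G) ^ (-1/8:ℝ) with hh
  have mh : Measurable h := by fun_prop
  have mp1 := aux_comp_inj (Measure.pi fun _ : Fin d => gaussianReal 0 1) (fun p => f (j, p))
    (fun p q hpq => by simpa using hf hpq)
  have mp2 := aux_uncurry (ι := Fin 8) (κ := Fin d) (Measure.pi fun _ : Fin d => gaussianReal 0 1)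
  set F : (Fin 8 × Fin d → Fin d → ℝ) → ℝ≥0∞ := fun w => ∏ k, h (fun i => w (k, i)) with hF
  have mF : Measurable F := Finset.measurable_prod _ fun k _ => mh.comp (by fun_prop)
  calc _ ≤ ∫⁻ W, F (fun p => W (f (j, p))) ∂(gm m d) := by
        refine lintegral_mono fun W => ?_
        rw [ENNReal.ofReal_sum_of_nonneg (fun _ _ => lam_nonneg _)]
        exact aux_inv_sum8 _
    _ = ∫⁻ w, F w ∂(Measure.pi fun _ => Measure.pi fun _ : Fin d => gaussianReal 0 1) :=
        mp1.lintegral_comp mF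
    _ = _ := (mp2.lintegral_comp mF).symm
    _ = _ := aux_lintegral_prod (gm d d) h mh 8

lemma aux_Lam {J d m : ℕ} (hJ : 0 < J) (f : Fin J × (Fin 8 × Fin d) → Fin m)
    (hf : Function.Injective f) :
    ∫⁻ W, (ENNReal.ofReal (Lam f W))⁻¹ ∂(gm m d) ≤
      (J : ℝ≥0∞)⁻¹ * (∫⁻ G, ENNReal.ofReal (lam G) ^ (-1/8:ℝ) ∂(gm d d)) ^ 8 := by
  have ml := meas_lam (d := d)
  have mS : ∀ j : Fin J, Measurable (fun W : Fin m → Fin d → ℝ =>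
      (ENNReal.ofReal (∑ k, lam (fun i => W (f (j, (k, i))))))⁻¹) := by
    intro j
    refine Measurable.inv (ENNReal.measurable_ofReal.comp ?_)
    exact Finset.measurable_sum _ fun k _ => ml.comp (by fun_prop)
  calc _ ≤ ∫⁻ W, ((J : ℝ≥0∞)⁻¹) ^ 2 * ∑ j, (ENNReal.ofReal (∑ k, lam (fun i => W (f (j, (k, i))))))⁻¹
          ∂(gm m d) :=
        lintegral_mono fun W => aux_harm hJ _ fun j => Finset.sum_nonneg fun _ _ => lam_nonneg _
    _ = ((J : ℝ≥0∞)⁻¹) ^ 2 * ∑ j, ∫⁻ W, (ENNReal.ofReal (∑ k, lam (fun i => W (f (j, (k, i))))))⁻¹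
          ∂(gm m d) := by
        rw [lintegral_const_mul _ (Finset.measurable_sum _ fun j _ => mS j),
          lintegral_finsetSum _ fun j _ => mS j]
    _ ≤ ((J : ℝ≥0∞)⁻¹) ^ 2 * ∑ _j : Fin J, (∫⁻ G, ENNReal.ofReal (lam G) ^ (-1/8:ℝ) ∂(gm d d)) ^ 8 := by
        gcongr with j _
        exact aux_block f hf j
    _ = _ := by
        rw [Finset.sum_const, Finset.card_univ, Fintype.card_fin, nsmul_eq_mul, ← mul_assoc, sq,
          mul_assoc _ _ (J : ℝ≥0∞), ENNReal.inv_mul_cancel (by simp; omega) (by simp), mul_one]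

/-- polynomial envelope -/
def Env {a d : ℕ} (β : Fin d → ℝ) (X : Fin a → Fin d → ℝ) : ℝ :=
  1 + (a + ((Matrix.of X *ᵥ β) ⬝ᵥ (Matrix.of X *ᵥ β) +
    ((Matrix.of X)ᵀ *ᵥ (Matrix.of X *ᵥ β)) ⬝ᵥ ((Matrix.of X)ᵀ *ᵥ (Matrix.of X *ᵥ β)) + β ⬝ᵥ β))

lemma Env_all {a d : ℕ} (β : Fin d → ℝ) : AllLp (gm a d) (Env (a := a) β) := by
  have h1 : ∀ i : Fin a, AllLp (gm a d) (fun X => (Matrix.of X *ᵥ β) i) := fun i =>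
    AllLp.sum Finset.univ (f := fun j (X : Fin a → Fin d → ℝ) => X i j * β j)
      fun j _ => (AllLp.coord i j).mul (AllLp.const _ _)
  have h2 : ∀ i : Fin d, AllLp (gm a d) (fun X => ((Matrix.of X)ᵀ *ᵥ (Matrix.of X *ᵥ β)) i) := fun i =>
    AllLp.sum Finset.univ (f := fun j (X : Fin a → Fin d → ℝ) => X j i * (Matrix.of X *ᵥ β) j)
      fun j _ => (AllLp.coord j i).mul (h1 j)
  refine (AllLp.const _ _).add ((AllLp.const _ _).add (((AllLp.sum _ fun i _ => ?_).add
    (AllLp.sum _ fun i _ => ?_)).add (AllLp.const _ _)))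
  · exact (h1 i).mul (h1 i)
  · exact (h2 i).mul (h2 i)

lemma aux_final {J a d m : ℕ} (hJ : 0 < J) (f : Fin J × (Fin 8 × Fin d) → Fin m)
    (hf : Function.Injective f) (β : Fin d → ℝ)
    (F : (Fin a → Fin d → ℝ) × (Fin m → Fin d → ℝ) → ℝ) (mF : Measurable F)
    (hF : ∀ p, 0 < Lam f p.2 → |F p| ≤ Env β p.1 / Lam f p.2) :
    Integrable F ((gm a d).prod (gm m d)) ∧
    |∫ p, F p ∂((gm a d).prod (gm m d))| ≤
      (∫⁻ X, ENNReal.ofReal (Env β X) ∂(gm a d)).toReal *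
        ((∫⁻ G, ENNReal.ofReal (lam G) ^ (-1/8:ℝ) ∂(gm d d)) ^ 8).toReal / J := by
  have hE1 : ∀ X : Fin a → Fin d → ℝ, 1 ≤ Env β X := by
    intro X
    unfold Env
    have := aux_dp_nonneg (Matrix.of X *ᵥ β)
    have := aux_dp_nonneg ((Matrix.of X)ᵀ *ᵥ (Matrix.of X *ᵥ β))
    have := aux_dp_nonneg β
    have : (0:ℝ) ≤ a := by positivity
    linarith
  set K := ∫⁻ X, ENNReal.ofReal (Env β X) ∂(gm a d) with hK
  set c := (∫⁻ G, ENNReal.ofReal (lam G) ^ (-1/8:ℝ) ∂(gm d d)) ^ 8 with hc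
  have Kt : K ≠ ∞ := (Env_all β).lint.ne
  have ct : c ≠ ∞ := ENNReal.pow_ne_top (aux_lam_mom d).ne
  have mE : AEMeasurable (fun X => ENNReal.ofReal (Env β X)) (gm a d) :=
    ENNReal.measurable_ofReal.comp_aemeasurable ((Env_all β) 1).aestronglyMeasurable.aemeasurable
  have mL : AEMeasurable (fun W => (ENNReal.ofReal (Lam f W))⁻¹) (gm m d) :=
    ((ENNReal.measurable_ofReal.comp (meas_Lam f)).inv).aemeasurable
  have bd : ∫⁻ p, ‖F p‖ₑ ∂((gm a d).prod (gm m d)) ≤ K * ((J : ℝ≥0∞)⁻¹ * c) := by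
    calc _ ≤ ∫⁻ p, ENNReal.ofReal (Env β p.1) * (ENNReal.ofReal (Lam f p.2))⁻¹ ∂((gm a d).prod (gm m d)) := by
          refine lintegral_mono fun p => ?_
          rcases (Lam_nonneg f p.2).eq_or_lt with h0 | h0
          · rw [← h0]
            have : ENNReal.ofReal (Env β p.1) ≠ 0 := by
              have := hE1 p.1
              simp; linarith
            simp [ENNReal.mul_top this]
          · rw [← ofReal_norm, ← div_eq_mul_inv, ← ENNReal.ofReal_div_of_pos h0]
            exact ENNReal.ofReal_le_ofReal (hF p h0)
      _ = K * ∫⁻ W, (ENNReal.ofReal (Lam f W))⁻¹ ∂(gm m d) := lintegral_prod_mul mE mL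
      _ ≤ _ := by gcongr; exact aux_Lam hJ f hf
  have fin : K * ((J : ℝ≥0∞)⁻¹ * c) ≠ ∞ :=
    ENNReal.mul_ne_top Kt (ENNReal.mul_ne_top (by simp; omega) ct)
  refine ⟨⟨mF.aestronglyMeasurable, lt_of_le_of_lt bd fin.lt_top⟩, ?_⟩
  have h1 : ‖∫ p, F p ∂((gm a d).prod (gm m d))‖ₑ ≤ K * ((J : ℝ≥0∞)⁻¹ * c) :=
    (enorm_integral_le_lintegral_enorm _).trans bd
  have h2 := ENNReal.toReal_mono fin h1
  rw [toReal_enorm, Real.norm_eq_abs, ENNReal.toReal_mul, ENNReal.toReal_mul, ENNReal.toReal_inv,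
    ENNReal.toReal_natCast] at h2
  refine h2.trans (le_of_eq ?_)
  ring

lemma meas_inv {a d m : ℕ} (i j : Fin d) : Measurable
    (fun p : (Fin a → Fin d → ℝ) × (Fin m → Fin d → ℝ) =>
      ((Matrix.of p.1)ᵀ * Matrix.of p.1 + (Matrix.of p.2)ᵀ * Matrix.of p.2)⁻¹ i j) := by
  have hX : Continuous (fun p : (Fin a → Fin d → ℝ) × (Fin m → Fin d → ℝ) => Matrix.of p.1) := by
    exact continuous_fst
  have hW : Continuous (fun p : (Fin a → Fin d → ℝ) × (Fin m → Fin d → ℝ) => Matrix.of p.2) := by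
    exact continuous_snd
  have hM : Continuous (fun p : (Fin a → Fin d → ℝ) × (Fin m → Fin d → ℝ) =>
    (Matrix.of p.1)ᵀ * Matrix.of p.1 + (Matrix.of p.2)ᵀ * Matrix.of p.2) :=
    (hX.matrix_transpose.matrix_mul hX).add (hW.matrix_transpose.matrix_mul hW)
  simp_rw [Matrix.inv_def, Ring.inverse_eq_inv', Matrix.smul_apply, smul_eq_mul]
  exact (hM.matrix_det.measurable.inv).mul (hM.matrix_adjugate.matrix_elem i j).measurable

lemma meas_gram {a d m : ℕ} (i j : Fin d) : Measurable
    (fun p : (Fin a → Fin d → ℝ) × (Fin m → Fin d → ℝ) =>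
      ((Matrix.of p.1)ᵀ * Matrix.of p.1) i j) := by
  simp only [Matrix.mul_apply, Matrix.transpose_apply, Matrix.of_apply]
  fun_prop

lemma meas_mul {α : Type*} [MeasurableSpace α] {d : ℕ} {A B : α → Matrix (Fin d) (Fin d) ℝ}
    (hA : ∀ i j, Measurable fun p => A p i j) (hB : ∀ i j, Measurable fun p => B p i j)
    (i j : Fin d) : Measurable fun p => (A p * B p) i j := by
  simp only [Matrix.mul_apply]
  exact Finset.measurable_sum _ fun k _ => (hA i k).mul (hB k j)

lemma meas_trace {α : Type*} [MeasurableSpace α] {d : ℕ} {A : α → Matrix (Fin d) (Fin d) ℝ}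
    (hA : ∀ i j, Measurable fun p => A p i j) : Measurable fun p => (A p).trace :=
  Finset.measurable_sum _ fun k _ => hA k k

lemma meas_EN {α : Type*} [MeasurableSpace α] {d : ℕ} {A : α → Matrix (Fin d) (Fin d) ℝ}
    (hA : ∀ i j, Measurable fun p => A p i j) (β : Fin d → ℝ) (c : ℝ) :
    Measurable fun p => EN ((A p - 1) *ᵥ β) ^ 2 - c := by
  unfold EN
  simp only [Matrix.mulVec, dotProduct, Matrix.sub_apply]
  fun_prop

theorem stmt19 (n₀ d₀ : ℕ) (β₀ : Fin d₀ → ℝ) (σ : ℝ) (hσ : 0 < σ) :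
    -- R n is the test error of β̂_{(n)} = (XᵀX + WₙᵀWₙ)⁻¹Xᵀy, where X is
    -- n₀ × d₀ and Wₙ is (n - n₀) × d₀, both with iid N(0,1) entries, independent:
    -- R n = σ² + E‖((XᵀX + WᵀW)⁻¹XᵀX - I)β₀‖² + σ²E trace(XᵀX(XᵀX + WᵀW)⁻²)
    let μ : (n : ℕ) → Measure ((Fin n₀ → Fin d₀ → ℝ) × (Fin (n - n₀) → Fin d₀ → ℝ)) :=
      fun n => (Measure.pi fun _ : Fin n₀ =>
          Measure.pi fun _ : Fin d₀ => gaussianReal 0 1).prod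
        (Measure.pi fun _ : Fin (n - n₀) =>
          Measure.pi fun _ : Fin d₀ => gaussianReal 0 1)
    let R : ℕ → ℝ := fun n =>
      σ ^ 2 +
      (∫ p, EN (((((Matrix.of p.1)ᵀ * Matrix.of p.1 +
            (Matrix.of p.2)ᵀ * Matrix.of p.2)⁻¹ *
              ((Matrix.of p.1)ᵀ * Matrix.of p.1)) - 1).mulVec β₀) ^ 2 ∂(μ n)) +
      σ ^ 2 *
        ∫ p, (((Matrix.of p.1)ᵀ * Matrix.of p.1) *
          (((Matrix.of p.1)ᵀ * Matrix.of p.1 + (Matrix.of p.2)ᵀ * Matrix.of p.2)⁻¹ *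
           ((Matrix.of p.1)ᵀ * Matrix.of p.1 +
             (Matrix.of p.2)ᵀ * Matrix.of p.2)⁻¹)).trace ∂(μ n)
    -- R n = σ² + ‖β₀‖² + O(n⁻¹) as n → ∞
    ∃ C : ℝ, ∃ N : ℕ, ∀ n ≥ N,
      |R n - (σ ^ 2 + ∑ i, β₀ i ^ 2)| ≤ C / n := by
  intro μ R
  set Q : ℝ := (∫⁻ X, ENNReal.ofReal (Env β₀ X) ∂(gm n₀ d₀)).toReal *
        ((∫⁻ G, ENNReal.ofReal (lam G) ^ (-1/8:ℝ) ∂(gm d₀ d₀)) ^ 8).toReal with hQ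
  have hQ0 : 0 ≤ Q := by positivity
  refine ⟨(1 + σ ^ 2) * Q * (32 * (d₀ + 1)), 2 * n₀ + 16 * (d₀ + 1), fun n hn => ?_⟩
  set J := (n - n₀) / (8 * (d₀ + 1)) with hJdef
  have hJ : 0 < J := Nat.div_pos (by omega) (by positivity)
  have hJm : J * (8 * (d₀ + 1)) ≤ n - n₀ := Nat.div_mul_le_self _ _
  have hJn : n ≤ 32 * (d₀ + 1) * J := by
    have h1 : n - n₀ < (J + 1) * (8 * (d₀ + 1)) := by
      exact (Nat.div_lt_iff_lt_mul (by positivity)).mp (Nat.lt_succ_self _)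
    have h2 : n ≤ 2 * (n - n₀) := by omega
    have h3 : (J + 1) * (8 * (d₀ + 1)) ≤ (2 * J) * (8 * (d₀ + 1)) := Nat.mul_le_mul_right _ (by omega)
    have : 32 * (d₀ + 1) * J = 2 * ((2 * J) * (8 * (d₀ + 1))) := by ring
    omega
  obtain ⟨f⟩ : Nonempty (Fin J × (Fin 8 × Fin d₀) ↪ Fin (n - n₀)) := by
    apply Function.Embedding.nonempty_of_card_le
    simp only [Fintype.card_prod, Fintype.card_fin]
    refine le_trans ?_ hJm
    gcongr
    omega
  have hn0 : (0:ℝ) < n := by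
    have : 0 < n := by omega
    exact_mod_cast this
  have hJ0 : (0:ℝ) < J := by exact_mod_cast hJ
  have hL := fun W => Lam_spec f f.injective W
  have posE : ∀ X : Fin n₀ → Fin d₀ → ℝ, (n₀ : ℝ) ≤ Env β₀ X ∧
      ((Matrix.of X *ᵥ β₀) ⬝ᵥ (Matrix.of X *ᵥ β₀) + ((Matrix.of X)ᵀ *ᵥ (Matrix.of X *ᵥ β₀)) ⬝ᵥ
        ((Matrix.of X)ᵀ *ᵥ (Matrix.of X *ᵥ β₀)) + β₀ ⬝ᵥ β₀) ≤ Env β₀ X := by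
    intro X
    unfold Env
    have := aux_dp_nonneg (Matrix.of X *ᵥ β₀)
    have := aux_dp_nonneg ((Matrix.of X)ᵀ *ᵥ (Matrix.of X *ᵥ β₀))
    have := aux_dp_nonneg β₀
    have : (0:ℝ) ≤ n₀ := by positivity
    constructor <;> linarith
  have mI := meas_inv (a := n₀) (d := d₀) (m := n - n₀)
  have mG := meas_gram (a := n₀) (d := d₀) (m := n - n₀)
  obtain ⟨i1, b1⟩ := aux_final hJ f f.injective β₀
    (fun p : (Fin n₀ → Fin d₀ → ℝ) × (Fin (n - n₀) → Fin d₀ → ℝ) =>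
      EN (((((Matrix.of p.1)ᵀ * Matrix.of p.1 +
            (Matrix.of p.2)ᵀ * Matrix.of p.2)⁻¹ *
              ((Matrix.of p.1)ᵀ * Matrix.of p.1)) - 1).mulVec β₀) ^ 2 - ∑ i, β₀ i ^ 2)
    (meas_EN (meas_mul mI mG) β₀ _)
    (fun p hp => (aux_bias (Matrix.of p.1) (Matrix.of p.2) β₀ hp (hL p.2)).trans
      (div_le_div_of_nonneg_right (posE p.1).2 hp.le))
  obtain ⟨i2, b2⟩ := aux_final hJ f f.injective β₀
    (fun p : (Fin n₀ → Fin d₀ → ℝ) × (Fin (n - n₀) → Fin d₀ → ℝ) =>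
      (((Matrix.of p.1)ᵀ * Matrix.of p.1) *
          (((Matrix.of p.1)ᵀ * Matrix.of p.1 + (Matrix.of p.2)ᵀ * Matrix.of p.2)⁻¹ *
           ((Matrix.of p.1)ᵀ * Matrix.of p.1 +
             (Matrix.of p.2)ᵀ * Matrix.of p.2)⁻¹)).trace)
    (meas_trace (meas_mul mG (meas_mul mI mI)))
    (fun p hp => (aux_var (Matrix.of p.1) (Matrix.of p.2) hp (hL p.2)).trans
      (div_le_div_of_nonneg_right (posE p.1).1 hp.le))
  rw [← hQ] at b1 b2
  have e1 : ∫ p, EN (((((Matrix.of p.1)ᵀ * Matrix.of p.1 +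
            (Matrix.of p.2)ᵀ * Matrix.of p.2)⁻¹ *
              ((Matrix.of p.1)ᵀ * Matrix.of p.1)) - 1).mulVec β₀) ^ 2 ∂(μ n) =
      ∫ p, (EN (((((Matrix.of p.1)ᵀ * Matrix.of p.1 +
            (Matrix.of p.2)ᵀ * Matrix.of p.2)⁻¹ *
              ((Matrix.of p.1)ᵀ * Matrix.of p.1)) - 1).mulVec β₀) ^ 2 - ∑ i, β₀ i ^ 2)
          ∂((gm n₀ d₀).prod (gm (n - n₀) d₀)) + ∑ i, β₀ i ^ 2 := by
    have := integral_add i1 (integrable_const (∑ i, β₀ i ^ 2))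
    simp only [sub_add_cancel, integral_const, probReal_univ, one_smul] at this
    exact this
  simp only [R]
  rw [e1]
  change |_ + _ + σ ^ 2 * (∫ p, _ ∂((gm n₀ d₀).prod (gm (n - n₀) d₀))) - _| ≤ _
  set I1 := ∫ p, (EN (((((Matrix.of p.1)ᵀ * Matrix.of p.1 +
            (Matrix.of p.2)ᵀ * Matrix.of p.2)⁻¹ *
              ((Matrix.of p.1)ᵀ * Matrix.of p.1)) - 1).mulVec β₀) ^ 2 - ∑ i, β₀ i ^ 2)
          ∂((gm n₀ d₀).prod (gm (n - n₀) d₀))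
  set I2 := ∫ p, (((Matrix.of p.1)ᵀ * Matrix.of p.1) *
          (((Matrix.of p.1)ᵀ * Matrix.of p.1 + (Matrix.of p.2)ᵀ * Matrix.of p.2)⁻¹ *
           ((Matrix.of p.1)ᵀ * Matrix.of p.1 +
             (Matrix.of p.2)ᵀ * Matrix.of p.2)⁻¹)).trace ∂((gm n₀ d₀).prod (gm (n - n₀) d₀))
  have hfin : Q / J ≤ Q * (32 * (d₀ + 1)) / n := by
    rw [div_le_div_iff₀ hJ0 hn0]
    have : (n:ℝ) ≤ 32 * (d₀ + 1) * J := by exact_mod_cast hJn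
    nlinarith
  have e2 : σ ^ 2 + (I1 + ∑ i, β₀ i ^ 2) + σ ^ 2 * I2 - (σ ^ 2 + ∑ i, β₀ i ^ 2) = I1 + σ ^ 2 * I2 := by
    ring
  rw [e2]
  calc |I1 + σ ^ 2 * I2| ≤ |I1| + σ ^ 2 * |I2| := by
        refine (abs_add_le _ _).trans ?_
        rw [abs_mul, abs_of_nonneg (sq_nonneg σ)]
    _ ≤ Q / J + σ ^ 2 * (Q / J) := by gcongr
    _ = (1 + σ ^ 2) * (Q / J) := by ring
    _ ≤ (1 + σ ^ 2) * (Q * (32 * (d₀ + 1)) / n) := by gcongr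
    _ = _ := by ring
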